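/- Let M = P + εD in 𝔻ℍ[t] be monic and let N ∈ 𝔻[t] be a monic degree-two polynomial dividing the norm polynomial N(M) = M·conj(M), such that the primal part of N does not divide P. Then there exists a unique dual quaternion h such that t − h is a right factor of M and (t − conj(h))(t − h) = N. -/

import Mathlib

open Polynomial TrivSqZeroExt Quaternion

noncomputable section

/-- the ring of dual numbers 𝔻 = ℝ[ε]/⟨ε²⟩ -/
abbrev DD : Type := DualNumber ℝ
/-- the Hamiltonian quaternions ℍ -/
abbrev HH : Type := Quaternion ℝ
/-- the dual quaternions 𝔻ℍ, realized as quaternions over the dual numbers -/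
abbrev DH : Type := Quaternion DD

/-- embedding of the real quaternions into the dual quaternions -/
def ofQ (p : HH) : DH := ⟨inl p.re, inl p.imI, inl p.imJ, inl p.imK⟩

/-- ε as a dual quaternion -/
def εq : DH := ((DualNumber.eps : DD) : DH)

/-- primal part of a dual quaternion -/
def primal (q : DH) : HH := ⟨(q.re).fst, (q.imI).fst, (q.imJ).fst, (q.imK).fst⟩

/-- dual part of a dual quaternion -/
def dualPart (q : DH) : HH := ⟨(q.re).snd, (q.imI).snd, (q.imJ).snd, (q.imK).snd⟩

/-- coefficientwise conjugate of a dual quaternion polynomial -/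
def pconj (M : Polynomial DH) : Polynomial DH := ∑ i ∈ M.support, C (star (M.coeff i)) * X ^ i

/-- coefficientwise conjugate of a quaternion polynomial -/
def qpconj (P : Polynomial HH) : Polynomial HH := ∑ i ∈ P.support, C (star (P.coeff i)) * X ^ i

/-- primal part of a dual quaternion polynomial -/
def Ppart (M : Polynomial DH) : Polynomial HH := ∑ i ∈ M.support, C (primal (M.coeff i)) * X ^ i

/-- dual part of a dual quaternion polynomial -/
def Dpart (M : Polynomial DH) : Polynomial HH := ∑ i ∈ M.support, C (dualPart (M.coeff i)) * X ^ i

/-- primal part of a dual number polynomial -/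
def dpr (p : Polynomial DD) : Polynomial ℝ := ∑ i ∈ p.support, C ((p.coeff i).fst) * X ^ i

/-- the dual number polynomial f + εg built from two real polynomials -/
def dpoly (f g : Polynomial ℝ) : Polynomial DD :=
  f.map (algebraMap ℝ DD) + (DualNumber.eps : DD) • g.map (algebraMap ℝ DD)

/-- embedding of quaternion polynomials into dual quaternion polynomials -/
def toDQp (P : Polynomial HH) : Polynomial DH := ∑ i ∈ P.support, C (ofQ (P.coeff i)) * X ^ i

/-- the quaternion unit i -/
def qi : HH := ⟨0, 1, 0, 0⟩
/-- the quaternion unit j -/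
def qj : HH := ⟨0, 0, 1, 0⟩
/-- the quaternion unit k -/
def qk : HH := ⟨0, 0, 0, 1⟩

section QuaternionPolynomial

variable {R S : Type*} [CommRing R] [CommRing S]

theorem coeff_sum_support_C_mul_X_pow {A B : Type*} [Semiring A] [Semiring B] (f : A → B)
    (hf : f 0 = 0) (M : Polynomial A) (n : ℕ) :
    (∑ i ∈ M.support, C (f (M.coeff i)) * X ^ i).coeff n = f (M.coeff n) := by
  simp only [finsetSum_coeff, coeff_C_mul, coeff_X_pow, mul_ite, mul_one, mul_zero,
    Finset.sum_ite_eq]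
  split_ifs with h
  · rfl
  · rw [notMem_support_iff.mp h, hf]

theorem sum_support_C_mul_X_pow_eq_map {A B : Type*} [Semiring A] [Semiring B] (f : A →+* B)
    (M : Polynomial A) : ∑ i ∈ M.support, C (f (M.coeff i)) * X ^ i = M.map f := by
  ext1 n
  rw [coeff_sum_support_C_mul_X_pow f (map_zero f), coeff_map]

/-- A left multiple of a monic polynomial whose degree does not exceed that of the polynomial is a
scalar multiple of it. -/
theorem exists_eq_C_of_natDegree_mul_monic_le {A : Type*} [Ring A] {p T : Polynomial A}
    (hp : p.Monic) (h : (T * p).natDegree ≤ p.natDegree) : ∃ c, T = C c := by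
  refine ⟨T.coeff 0, eq_C_of_natDegree_eq_zero ?_⟩
  by_cases hT : T = 0
  · rw [hT, natDegree_zero]
  · rw [natDegree_mul' (by rwa [hp.leadingCoeff, mul_one, leadingCoeff_ne_zero])] at h
    omega

theorem X_sub_C_mul_X_sub_C {A : Type*} [Ring A] (a b : A) :
    (X - C a) * (X - C b) = X ^ 2 - C (a + b) * X + C (a * b) := by
  rw [sub_mul, mul_sub, mul_sub, X_mul_C, C_add, C_mul]
  noncomm_ring

/-- coefficientwise conjugate of a polynomial over a quaternion algebra -/
def conjPoly (M : Polynomial ℍ[R]) : Polynomial ℍ[R] :=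
  ∑ i ∈ M.support, C (star (M.coeff i)) * X ^ i

theorem coeff_conjPoly (M : Polynomial ℍ[R]) (n : ℕ) :
    (conjPoly M).coeff n = star (M.coeff n) :=
  coeff_sum_support_C_mul_X_pow star (star_zero _) M n

theorem conjPoly_sub (A B : Polynomial ℍ[R]) : conjPoly (A - B) = conjPoly A - conjPoly B := by
  ext1 n
  simp only [coeff_conjPoly, coeff_sub, star_sub]

theorem conjPoly_mul (A B : Polynomial ℍ[R]) : conjPoly (A * B) = conjPoly B * conjPoly A := by
  ext1 n
  rw [coeff_conjPoly, coeff_mul, coeff_mul, star_sum, ← Finset.Nat.sum_antidiagonal_swap]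
  simp only [coeff_conjPoly, star_mul, Prod.fst_swap, Prod.snd_swap]

theorem conjPoly_map_algebraMap (N : Polynomial R) :
    conjPoly (N.map (algebraMap R ℍ[R])) = N.map (algebraMap R ℍ[R]) := by
  ext1 n
  rw [coeff_conjPoly, coeff_map, Quaternion.algebraMap_def, Quaternion.star_coe]

theorem conjPoly_linear (a b : ℍ[R]) :
    conjPoly (C a * X + C b) = C (star a) * X + C (star b) := by
  ext1 n
  rw [coeff_conjPoly]
  simp only [coeff_add, coeff_C_mul, coeff_X, coeff_C, mul_ite, mul_one, mul_zero, star_add]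
  split_ifs <;> simp only [star_zero]

theorem map_algebraMap_commute {A : Type*} [Ring A] [Algebra R A] (N : Polynomial R)
    (M : Polynomial A) : Commute (N.map (algebraMap R A)) M := by
  change _ * _ = _ * _
  ext1 n
  rw [coeff_mul, coeff_mul, ← Finset.Nat.sum_antidiagonal_swap]
  simp only [coeff_map, Prod.fst_swap, Prod.snd_swap, Algebra.commutes]

/-- componentwise application of a function to a quaternion -/
def quatMapFun (φ : R → S) (q : ℍ[R]) : ℍ[S] := ⟨φ q.re, φ q.imI, φ q.imJ, φ q.imK⟩

@[simp] theorem re_quatMapFun (φ : R → S) (q : ℍ[R]) : (quatMapFun φ q).re = φ q.re := rfl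

@[simp] theorem imI_quatMapFun (φ : R → S) (q : ℍ[R]) : (quatMapFun φ q).imI = φ q.imI := rfl

@[simp] theorem imJ_quatMapFun (φ : R → S) (q : ℍ[R]) : (quatMapFun φ q).imJ = φ q.imJ := rfl

@[simp] theorem imK_quatMapFun (φ : R → S) (q : ℍ[R]) : (quatMapFun φ q).imK = φ q.imK := rfl

/-- the ring homomorphism of quaternions induced by a homomorphism of coefficient rings -/
def quatMap (φ : R →+* S) : ℍ[R] →+* ℍ[S] where
  toFun := quatMapFun φ
  map_one' := by ext <;> simp
  map_zero' := by ext <;> simp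
  map_add' a b := by ext <;> simp
  map_mul' a b := by ext <;> simp

theorem quatMap_apply (φ : R →+* S) (q : ℍ[R]) : quatMap φ q = quatMapFun φ q := rfl

theorem quatMap_coe (φ : R →+* S) (r : R) : quatMap φ (r : ℍ[R]) = ((φ r : S) : ℍ[S]) := by
  ext <;> simp [quatMap_apply]

theorem map_normSq (φ : R →+* S) (q : ℍ[R]) :
    φ (Quaternion.normSq q) = Quaternion.normSq (quatMap φ q) := by
  simp [Quaternion.normSq_def', quatMap_apply]

theorem map_map_algebraMap (φ : R →+* S) (N : Polynomial R) :
    (N.map φ).map (algebraMap S ℍ[S]) = (N.map (algebraMap R ℍ[R])).map (quatMap φ) := by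
  ext1 n
  simp only [coeff_map, Quaternion.algebraMap_def, quatMap_coe]

theorem isUnit_of_isUnit_normSq {q : ℍ[R]} (hq : IsUnit (Quaternion.normSq q)) : IsUnit q := by
  obtain ⟨v, hv⟩ := hq.exists_right_inv
  have hv' : ((Quaternion.normSq q : R) : ℍ[R]) * (v : ℍ[R]) = 1 := by
    rw [← Quaternion.coe_mul, hv, Quaternion.coe_one]
  refine ⟨⟨q, star q * v, ?_, ?_⟩, rfl⟩
  · rw [← mul_assoc, Quaternion.self_mul_star, hv']
  · rw [mul_assoc, (Quaternion.coe_commutes v q), ← mul_assoc, Quaternion.star_mul_self, hv']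

theorem linear_mul_conjPoly (a b : ℍ[R]) : (C a * X + C b) * conjPoly (C a * X + C b) =
    C (a * star a) * X ^ 2 + C (a * star b + b * star a) * X + C (b * star b) := by
  rw [conjPoly_linear]
  simp only [C_add, C_mul, mul_add, add_mul, pow_two]
  have h1 : C a * X * (C (star a) * X) = C a * C (star a) * (X * X) := by
    rw [mul_assoc, ← mul_assoc X, X_mul_C, mul_assoc, mul_assoc]
  have h2 : C a * X * C (star b) = C a * C (star b) * X := by
    rw [mul_assoc, X_mul_C, mul_assoc]
  rw [h1, h2, ← mul_assoc (C b)]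
  abel

/-- The coefficient conditions for a linear quaternion polynomial whose norm polynomial is a
multiple of a monic quadratic polynomial. -/
theorem normSq_relations [Nontrivial R] {a b : ℍ[R]} {m n : R} {T : Polynomial ℍ[R]}
    (h : (C a * X + C b) * conjPoly (C a * X + C b) =
      T * (X ^ 2 + C (m : ℍ[R]) * X + C (n : ℍ[R]))) :
    a * star b + b * star a = ((Quaternion.normSq a * m : R) : ℍ[R]) ∧
      Quaternion.normSq b = Quaternion.normSq a * n := by
  have hmon : (X ^ 2 + C (m : ℍ[R]) * X + C (n : ℍ[R])).Monic := by monicity!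
  have hdeg : (X ^ 2 + C (m : ℍ[R]) * X + C (n : ℍ[R])).natDegree = 2 := by compute_degree!
  obtain ⟨c, rfl⟩ : ∃ c, T = C c := by
    apply exists_eq_C_of_natDegree_mul_monic_le hmon
    rw [← h, hdeg, linear_mul_conjPoly]
    compute_degree
  rw [linear_mul_conjPoly] at h
  have h2 := congrArg (coeff · 2) h
  have h1 := congrArg (coeff · 1) h
  have h0 := congrArg (coeff · 0) h
  simp only [coeff_add, coeff_C_mul, coeff_X, coeff_C, coeff_X_pow] at h0 h1 h2
  norm_num at h0 h1 h2
  rw [Quaternion.self_mul_star] at h2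
  rw [← h2, ← Quaternion.coe_mul] at h0 h1
  rw [Quaternion.self_mul_star] at h0
  exact ⟨h1, Quaternion.coe_injective h0⟩

/-- Existence and uniqueness of a linear right factor with prescribed quadratic norm polynomial,
over the quaternions with coefficients in a ring that maps locally to the reals. -/
theorem existsUnique_linear_right_factor (φ : R →+* ℝ) [IsLocalHom φ] (M : Polynomial ℍ[R])
    (N : Polynomial R) (hNmon : N.Monic) (hnat : N.natDegree = 2)
    (NM : Polynomial R) (hNM : NM.map (algebraMap R ℍ[R]) = M * conjPoly M) (hdvd : N ∣ NM)
    (hnd : ¬ ((N.map φ).map (algebraMap ℝ ℍ[ℝ]) ∣ M.map (quatMap φ))) :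
    ∃! h : ℍ[R], (∃ Q : Polynomial ℍ[R], M = Q * (X - C h)) ∧
      (X - C (star h)) * (X - C h) = N.map (algebraMap R ℍ[R]) := by
  have : Nontrivial R := φ.domain_nontrivial
  set NN := N.map (algebraMap R ℍ[R]) with hNN
  have hNNmon : NN.Monic := hNmon.map _
  have hcomm (A : Polynomial ℍ[R]) : NN * A = A * NN := map_algebraMap_commute N A
  have hNeq : NN = X ^ 2 + C ((N.coeff 1 : R) : ℍ[R]) * X + C ((N.coeff 0 : R) : ℍ[R]) := by
    have h2 : N.coeff 2 = 1 := by rw [← hnat]; exact hNmon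
    have := N.as_sum_range_C_mul_X_pow
    rw [hnat] at this
    simp only [Finset.sum_range_succ, Finset.sum_range_zero, h2] at this
    rw [hNN, this]
    simp [Quaternion.algebraMap_def]
    abel
  have hNNdeg : NN.natDegree = 2 := by rw [hNmon.natDegree_map, hnat]
  set Q := M /ₘ NN
  obtain ⟨a, b, hab⟩ : ∃ a b, M %ₘ NN = C a * X + C b := by
    refine exists_eq_X_add_C_of_natDegree_le_one ?_
    have := natDegree_modByMonic_lt M hNNmon (by rintro h; simp [h] at hNNdeg)
    omega
  have hR : M - Q * NN = C a * X + C b := by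
    rw [← hab, ← hcomm, sub_eq_iff_eq_add]
    exact (modByMonic_add_div M NN).symm
  obtain ⟨K, hK⟩ := hdvd
  obtain ⟨T, hT⟩ : ∃ T, (C a * X + C b) * conjPoly (C a * X + C b) = T * NN := by
    refine ⟨K.map (algebraMap R ℍ[R]) - M * conjPoly Q - Q * conjPoly M + Q * NN * conjPoly Q, ?_⟩
    rw [← hR, conjPoly_sub, conjPoly_mul, hNN, conjPoly_map_algebraMap, ← hNN, hcomm,
      sub_mul, mul_sub, mul_sub, ← hNM, hK, Polynomial.map_mul, ← hNN, hcomm, mul_assoc Q NN,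
      hcomm]
    noncomm_ring
  rw [hNeq] at hT
  obtain ⟨hm, hn⟩ := normSq_relations hT
  have ha : quatMap φ a ≠ 0 := by
    intro ha
    have hb : quatMap φ b = 0 := by
      rw [← Quaternion.normSq_eq_zero, ← map_normSq, hn, map_mul, map_normSq, ha, map_zero,
        zero_mul]
    apply hnd
    rw [map_map_algebraMap, ← sub_add_cancel M (Q * NN), hR, ← hcomm]
    exact ⟨Q.map (quatMap φ), by simp [ha, hb, Polynomial.map_mul, hNN]⟩
  have hua : IsUnit (Quaternion.normSq a) := by
    apply isUnit_of_map_unit φ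
    rw [map_normSq, isUnit_iff_ne_zero]
    exact Quaternion.normSq_ne_zero.mpr ha
  have hau := isUnit_of_isUnit_normSq hua
  obtain ⟨h, hb⟩ : ∃ h, b = -(a * h) := by
    obtain ⟨v, hv⟩ := hau.exists_right_inv
    exact ⟨-(v * b), by rw [mul_neg, neg_neg, ← mul_assoc, hv, one_mul]⟩
  have hlin : C a * X + C b = C a * (X - C h) := by
    rw [hb, mul_sub, C_neg, C_mul, sub_eq_add_neg]
  have hnorm : (X - C (star h)) * (X - C h) = NN := by
    rw [X_sub_C_mul_X_sub_C, hNeq]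
    have h0 : Quaternion.normSq h = N.coeff 0 := by
      rw [hb, Quaternion.normSq_neg, map_mul] at hn
      exact hua.mul_left_cancel hn
    have h1 : star h + h = -((N.coeff 1 : R) : ℍ[R]) := by
      have e : a * star b + b * star a = -(a * (star h + h) * star a) := by
        rw [hb, star_neg, star_mul]
        noncomm_ring
      rw [e, Quaternion.star_add_self', ← Quaternion.coe_commutes, mul_assoc,
        Quaternion.self_mul_star, ← Quaternion.coe_mul, ← Quaternion.coe_neg] at hm
      rw [Quaternion.star_add_self', ← Quaternion.coe_neg]
      congr 1
      apply hua.mul_left_cancel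
      rw [mul_neg, ← Quaternion.coe_injective hm, neg_neg, mul_comm]
    rw [Quaternion.star_mul_self, h0, h1, C_neg, neg_mul, sub_neg_eq_add]
  refine ⟨h, ⟨⟨Q * (X - C (star h)) + C a, ?_⟩, hnorm⟩, ?_⟩
  · rw [add_mul, mul_assoc, hnorm, ← hlin, ← hR]
    abel
  · rintro g ⟨⟨T', hT'⟩, hg⟩
    have hfac : C a * X + C b = (T' - Q * (X - C (star g))) * (X - C g) := by
      rw [sub_mul, mul_assoc, hg, ← hT', ← hR]
    obtain ⟨c, hc⟩ := exists_eq_C_of_natDegree_mul_monic_le (T := T' - Q * (X - C (star g)))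
      (monic_X_sub_C g) (by
        rw [← hfac, natDegree_X_sub_C]
        exact natDegree_linear_le)
    rw [hc, hlin] at hfac
    have h1 := congrArg (coeff · 1) hfac
    have h0 := congrArg (coeff · 0) hfac
    simp only [coeff_C_mul, coeff_sub, coeff_X_one, coeff_X_zero, coeff_C_succ, coeff_C_zero,
      sub_zero, mul_one, zero_sub, mul_neg, neg_inj] at h0 h1
    rw [← h1] at h0
    exact (hau.mul_left_cancel h0).symm

end QuaternionPolynomial

/-- If M is monic, N ∈ 𝔻[t] is a monic quadratic factor of the norm polynomial N(M) whose
primal part does not divide the primal part of M, then there is a unique h such that t − h is a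
right factor of M and (t − conj h)(t − h) = N. -/
theorem stmt9 (M : Polynomial DH) (hM : M.Monic)
    (N : Polynomial DD) (hNmon : N.Monic) (hNdeg : N.degree = 2)
    (NM : Polynomial DD) (hNM : NM.map (algebraMap DD DH) = M * pconj M)
    (hdvd : N ∣ NM)
    (hnd : ¬ ((dpr N).map (algebraMap ℝ HH) ∣ Ppart M)) :
    ∃! h : DH, (∃ Q : Polynomial DH, M = Q * (X - C h)) ∧
      (X - C (star h)) * (X - C h) = N.map (algebraMap DD DH) := by
  have hlocal : IsLocalHom (TrivSqZeroExt.fstHom ℝ ℝ ℝ : DD →+* ℝ) :=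
    ⟨fun _ h => TrivSqZeroExt.isUnit_iff_isUnit_fst.mpr h⟩
  have hdpr : dpr N = N.map (TrivSqZeroExt.fstHom ℝ ℝ ℝ : DD →+* ℝ) :=
    sum_support_C_mul_X_pow_eq_map (TrivSqZeroExt.fstHom ℝ ℝ ℝ : DD →+* ℝ) N
  have hP : Ppart M = M.map (quatMap (TrivSqZeroExt.fstHom ℝ ℝ ℝ : DD →+* ℝ)) :=
    sum_support_C_mul_X_pow_eq_map (quatMap (TrivSqZeroExt.fstHom ℝ ℝ ℝ : DD →+* ℝ)) M
  rw [hdpr, hP] at hnd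
  exact existsUnique_linear_right_factor (TrivSqZeroExt.fstHom ℝ ℝ ℝ : DD →+* ℝ) M N hNmon
    (natDegree_eq_of_degree_eq_some hNdeg) NM hNM hdvd hnd
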